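/- Let (X, r) be a non-degenerate involutive set-theoretic solution of the Yang–Baxter equation with |X| = m ≥ 2, and let λ ∈ P(n, m) have exactly k positive parts. Then the number of λ-elements in X^n is m!/(m−k)!. -/

import Mathlib

/-! Set-theoretic solutions of the Yang–Baxter equation.
For `r : X × X → X × X` we write `r (i, j) = (σ i j, τ j i)`, i.e. `σ_i(j) = σ i j` and
`τ_j(i) = τ j i`. -/

variable {X : Type*}

/-- The map `r : X × X → X × X` determined by families `σ`, `τ` via
`r (i, j) = (σ_i(j), τ_j(i))`. -/
def rmapF (σ τ : X → X → X) : X × X → X × X := fun p => (σ p.1 p.2, τ p.2 p.1)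

/-- `r × id` on `X × X × X`. -/
def ridF (r : X × X → X × X) : X × X × X → X × X × X :=
  fun p => ((r (p.1, p.2.1)).1, (r (p.1, p.2.1)).2, p.2.2)

/-- `id × r` on `X × X × X`. -/
def idrF (r : X × X → X × X) : X × X × X → X × X × X := fun p => (p.1, r p.2)

/-- The braid (Yang–Baxter) equation `(r × id) ∘ (id × r) ∘ (r × id) = (id × r) ∘ (r × id) ∘ (id × r)`. -/
def BraidEq (r : X × X → X × X) : Prop :=
  ridF r ∘ idrF r ∘ ridF r = idrF r ∘ ridF r ∘ idrF r

/-- A non-degenerate involutive set-theoretic solution of the Yang–Baxter equation on `X`: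
the maps `σ_i` and `τ_i` are bijective (packaged as equivalences), the induced map
`r (i, j) = (σ_i(j), τ_j(i))` satisfies the braid equation, and `r ∘ r = id`
(which in particular makes `r` bijective). -/
structure NDIS (X : Type*) where
  σ : X → X ≃ X
  τ : X → X ≃ X
  braid : BraidEq (rmapF (fun i => ⇑(σ i)) (fun i => ⇑(τ i)))
  invol : ∀ p : X × X,
    rmapF (fun i => ⇑(σ i)) (fun i => ⇑(τ i))
      (rmapF (fun i => ⇑(σ i)) (fun i => ⇑(τ i)) p) = p

namespace NDIS

/-- The map `r` of the solution. -/
def r (S : NDIS X) : X × X → X × X := rmapF (fun i => ⇑(S.σ i)) (fun i => ⇑(S.τ i))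

/-- The diagonal `D : X → X`, `D(i) = τ_i⁻¹(i)`. -/
def D (S : NDIS X) : X → X := fun i => (S.τ i).symm i

end NDIS
namespace NDIS

/-- One elementary move on words: apply `r` to two adjacent letters. -/
def Step (S : NDIS X) (x y : List X) : Prop :=
  ∃ (u v : List X) (i j : X), x = u ++ i :: j :: v ∧ y = u ++ S.σ i j :: S.τ j i :: v

/-- The orbit `O(x)` of a word `x` under the equivalence relation generated by the
adjacent `r`-moves (equivalently, the orbit of the induced `S_n`-action on `X^n`). -/
def Orb (S : NDIS X) (x : List X) : Set (List X) := {y | Relation.EqvGen S.Step x y}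

/-- `Ψ_k(a) = (D^{k−1}(a), …, D(a), a)`. -/
def Psi (S : NDIS X) (k : ℕ) (a : X) : List X :=
  (List.range k).map fun t => S.D^[k - 1 - t] a

/-- The inverse of the diagonal `D`. -/
noncomputable def Dinv (S : NDIS X) [Nonempty X] : X → X := Function.invFun S.D

/-- `Ψ_{−k}(a) = (a, D^{−1}(a), …, D^{−(k−1)}(a))`. -/
noncomputable def PsiNeg (S : NDIS X) [Nonempty X] (k : ℕ) (a : X) : List X :=
  (List.range k).map fun t => S.Dinv^[t] a

/-- `σ_x = σ_{a_1} ∘ σ_{a_2} ∘ ⋯ ∘ σ_{a_k}` for a word `x = (a_1, …, a_k)`. -/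
def sigmaWord (S : NDIS X) (x : List X) (z : X) : X := x.foldr (fun a w => S.σ a w) z

/-- `τ_x = τ_{a_k} ∘ ⋯ ∘ τ_{a_2} ∘ τ_{a_1}` for a word `x = (a_1, …, a_k)`. -/
def tauWord (S : NDIS X) (x : List X) (z : X) : X := x.foldl (fun w a => S.τ a w) z

/-- The concatenation `Ψ_{L 0}(a 0) Ψ_{L 1}(a 1) ⋯ Ψ_{L (k-1)}(a (k-1))`. -/
def word (S : NDIS X) {k : ℕ} (L : Fin k → ℕ) (a : Fin k → X) : List X :=
  (List.ofFn fun t => S.Psi (L t) (a t)).flatten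

/-- The concatenation `Ψ_{L (i+1)}(a (i+1)) ⋯ Ψ_{L (j-1)}(a (j-1))` of the blocks strictly
between positions `i` and `j` (the empty word when `j = i + 1`). -/
def midword (S : NDIS X) {k : ℕ} (L : Fin k → ℕ) (a : Fin k → X) (i j : Fin k) : List X :=
  (((List.ofFn fun t => S.Psi (L t) (a t)).drop ((i : ℕ) + 1)).take ((j : ℕ) - (i : ℕ) - 1)).flatten

/-- The family `a` yields a `λ`-element: `a_j ≠ D^{−λ_j}(τ_w(a_i))` for all `i < j`, with
`w = Ψ_{λ_{i+1}}(a_{i+1}) ⋯ Ψ_{λ_{j−1}}(a_{j−1})`. -/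
def IsLambdaFamily (S : NDIS X) [Nonempty X] {k : ℕ} (L : Fin k → ℕ) (a : Fin k → X) : Prop :=
  ∀ i j : Fin k, i < j →
    a j ≠ S.Dinv^[L j] (S.tauWord (S.midword L a i j) (a i))

/-- `x` is a `λ`-element for the partition with positive parts `L 0 ≥ L 1 ≥ ⋯ ≥ L (k-1) > 0`. -/
def IsLambdaWord (S : NDIS X) [Nonempty X] {k : ℕ} (L : Fin k → ℕ) (x : List X) : Prop :=
  ∃ a : Fin k → X, x = S.word L a ∧ S.IsLambdaFamily L a

/-- The bijection `b` of `X^n` applying `r` to the entries in (0-based) positions `j` and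
`j + 1` and fixing all other entries. -/
def bmap (S : NDIS X) {n : ℕ} (j : ℕ) (hj : j + 1 < n) (x : Fin n → X) : Fin n → X :=
  fun t =>
    if (t : ℕ) = j then S.σ (x ⟨j, by omega⟩) (x ⟨j + 1, hj⟩)
    else if (t : ℕ) = j + 1 then S.τ (x ⟨j + 1, hj⟩) (x ⟨j, by omega⟩)
    else x t

/-- One elementary move on `X^n` (as functions `Fin n → X`). -/
def StepF (S : NDIS X) {n : ℕ} (x y : Fin n → X) : Prop :=
  ∃ (j : ℕ) (hj : j + 1 < n), y = S.bmap j hj x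

end NDIS

/-- The offset `λ_1 + ⋯ + λ_i` of the `i`-th block (0-based). -/
def blockOffset {k : ℕ} (L : Fin k → ℕ) (i : Fin k) : ℕ :=
  ∑ t ∈ Finset.univ.filter (fun t => t < i), L t

/-- A `(λ_1, …, λ_k)`-shuffle: a permutation strictly increasing on each consecutive block. -/
def IsShuffle {k n : ℕ} (L : Fin k → ℕ) (θ : Equiv.Perm (Fin n)) : Prop :=
  ∀ (i : Fin k) (p q : Fin n), blockOffset L i ≤ (p : ℕ) → p < q →
    (q : ℕ) < blockOffset L i + L i → θ p < θ q

namespace NDIS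

theorem D_injective (S : NDIS X) : Function.Injective S.D := by
  have key : ∀ i, (S.σ (S.D i)) i = S.D i := by
    intro i
    have h1 : S.τ i (S.D i) = i := by simp [D]
    have h2 := S.invol (S.D i, i)
    simp only [rmapF, h1, Prod.mk.injEq] at h2
    exact (S.τ i).injective (h2.2.trans h1.symm)
  intro i j hij
  have hi := key i
  have hj := key j
  rw [← hij] at hj
  exact (S.σ (S.D i)).injective (hi.trans hj.symm)

theorem tauWord_append (S : NDIS X) (u v : List X) (z : X) :
    S.tauWord (u ++ v) z = S.tauWord v (S.tauWord u z) := by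
  simp [tauWord]

theorem tauWord_injective (S : NDIS X) (u : List X) : Function.Injective (S.tauWord u) := by
  induction u with
  | nil => intro a b h; exact h
  | cons x u ih =>
    intro a b h
    exact (S.τ x).injective (ih h)

theorem Psi_succ (S : NDIS X) (k : ℕ) (a : X) :
    S.Psi (k + 1) a = S.D^[k] a :: S.Psi k a := by
  simp only [Psi, List.range_succ_eq_map, List.map_cons, List.map_map]
  congr 1
  apply List.map_congr_left
  intro t _
  have h : k + 1 - 1 - Nat.succ t = k - 1 - t := by omega
  simp only [Function.comp, h]

theorem tauWord_Psi (S : NDIS X) (k : ℕ) (a : X) :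
    S.tauWord (S.Psi k a) (S.D^[k] a) = a := by
  induction k with
  | zero => simp [Psi, tauWord]
  | succ k ih =>
    rw [Psi_succ, Function.iterate_succ_apply']
    have h : S.τ (S.D^[k] a) (S.D (S.D^[k] a)) = S.D^[k] a := by simp [D]
    change S.tauWord (S.Psi k a) (S.τ (S.D^[k] a) (S.D (S.D^[k] a))) = a
    rw [h, ih]

theorem eq_Dinv_iff [Finite X] [Nonempty X] (S : NDIS X) (k : ℕ) (a c : X) :
    a = S.Dinv^[k] c ↔ S.tauWord (S.Psi k a) c = a := by
  have hl : Function.LeftInverse S.Dinv S.D := Function.leftInverse_invFun S.D_injective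
  have hr : Function.RightInverse S.Dinv S.D :=
    Function.rightInverse_invFun (Finite.surjective_of_injective S.D_injective)
  constructor
  · rintro h
    have h2 : S.D^[k] a = c := by rw [h]; exact (hr.iterate k) c
    rw [← h2, tauWord_Psi]
  · intro h
    have h2 : c = S.D^[k] a := S.tauWord_injective _ (h.trans (S.tauWord_Psi k a).symm)
    rw [h2]; exact ((hl.iterate k) a).symm

/-- Transport all the letters `a i` to the end of the word. -/
def endMap (S : NDIS X) {k : ℕ} (L : Fin k → ℕ) (a : Fin k → X) (i : Fin k) : X :=
  S.tauWord ((List.ofFn fun t => S.Psi (L t) (a t)).drop ((i : ℕ) + 1)).flatten (a i)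

theorem endMap_injective (S : NDIS X) {k : ℕ} (L : Fin k → ℕ) :
    Function.Injective (S.endMap L) := by
  intro a b hab
  have key : ∀ d : ℕ, ∀ i : Fin k, k - (i : ℕ) ≤ d → a i = b i := by
    intro d
    induction d with
    | zero => intro i hi; have := i.2; omega
    | succ d ih =>
      intro i hi
      have hd : (List.ofFn fun t => S.Psi (L t) (a t)).drop ((i : ℕ) + 1) =
          (List.ofFn fun t => S.Psi (L t) (b t)).drop ((i : ℕ) + 1) := by
        apply List.ext_getElem
        · simp
        · intro n h1 h2
          simp only [List.length_drop, List.length_ofFn] at h1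
          simp only [List.getElem_drop, List.getElem_ofFn]
          rw [ih ⟨(i : ℕ) + 1 + n, by omega⟩ (by simp only; omega)]
      have h := congrFun hab i
      simp only [endMap, hd] at h
      exact S.tauWord_injective _ h
  funext i
  exact key _ i le_rfl

theorem drop_flatten (S : NDIS X) {k : ℕ} (L : Fin k → ℕ) (a : Fin k → X) (i j : Fin k)
    (hij : i < j) :
    ((List.ofFn fun t => S.Psi (L t) (a t)).drop ((i : ℕ) + 1)).flatten =
      S.midword L a i j ++ (S.Psi (L j) (a j) ++
        ((List.ofFn fun t => S.Psi (L t) (a t)).drop ((j : ℕ) + 1)).flatten) := by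
  have hij' : (i : ℕ) < j := hij
  have h1 := List.take_append_drop ((j : ℕ) - i - 1)
    ((List.ofFn fun t => S.Psi (L t) (a t)).drop ((i : ℕ) + 1))
  have h2 : (i : ℕ) + 1 + ((j : ℕ) - i - 1) = j := by omega
  rw [List.drop_drop, h2, List.drop_eq_getElem_cons (i := (j : ℕ)) (by simp), List.getElem_ofFn] at h1
  rw [← h1, List.flatten_append, List.flatten_cons, midword]

theorem isLambdaFamily_iff [Finite X] [Nonempty X] (S : NDIS X) {k : ℕ} (L : Fin k → ℕ)
    (a : Fin k → X) : S.IsLambdaFamily L a ↔ Function.Injective (S.endMap L a) := by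
  have key : ∀ i j : Fin k, i < j →
      (a j = S.Dinv^[L j] (S.tauWord (S.midword L a i j) (a i)) ↔
        S.endMap L a i = S.endMap L a j) := by
    intro i j hij
    rw [eq_Dinv_iff, endMap, S.drop_flatten L a i j hij, tauWord_append, tauWord_append, endMap]
    exact (S.tauWord_injective _).eq_iff.symm
  constructor
  · intro h i j hij
    rcases lt_trichotomy i j with hlt | heq | hgt
    · exact absurd ((key i j hlt).2 hij) (h i j hlt)
    · exact heq
    · exact absurd ((key j i hgt).2 hij.symm) (h j i hgt)
  · intro h i j hij he
    exact hij.ne (h ((key i j hij).1 he))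

theorem word_injective (S : NDIS X) {k : ℕ} (L : Fin k → ℕ) (hpos : ∀ t, 0 < L t) :
    Function.Injective (S.word L) := by
  intro a b hab
  have h : (List.ofFn fun t => S.Psi (L t) (a t)) = List.ofFn fun t => S.Psi (L t) (b t) := by
    rw [List.eq_iff_flatten_eq]
    refine ⟨hab, ?_⟩
    rw [List.map_ofFn, List.map_ofFn]
    congr 1
    funext t
    simp [Psi]
  have h' := List.ofFn_injective h
  funext t
  have ht := congrFun h' t
  obtain ⟨m, hm⟩ := Nat.exists_eq_succ_of_ne_zero (hpos t).ne'
  simp only [hm, Nat.succ_eq_add_one, Psi_succ, List.cons.injEq] at ht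
  exact (S.D_injective.iterate m) ht.1

end NDIS

/-- Let `(X, r)` be a non-degenerate involutive solution with `|X| = m ≥ 2`
and let `λ ∈ P(n, m)` have exactly `k` positive parts `L`. Then the number of
`λ`-elements in `X^n` is `m!/(m−k)!`. -/
theorem card_lambda_elements {X : Type*} [Fintype X] [Nonempty X]
    (S : NDIS X) (hm : 2 ≤ Fintype.card X)
    {n k : ℕ} (L : Fin k → ℕ) (hpos : ∀ t, 0 < L t) (hmono : Antitone L)
    (hsum : ∑ t, L t = n) (hk : k ≤ Fintype.card X) :
    {x : List X | S.IsLambdaWord L x}.ncard =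
      Nat.factorial (Fintype.card X) / Nat.factorial (Fintype.card X - k) := by
  classical
  have h1 : {x : List X | S.IsLambdaWord L x} =
      Set.image (S.word L) {a : Fin k → X | Function.Injective (S.endMap L a)} := by
    ext x
    simp only [Set.mem_ofPred_eq, NDIS.IsLambdaWord, Set.mem_image, NDIS.isLambdaFamily_iff]
    constructor
    · rintro ⟨a, rfl, ha⟩
      exact ⟨a, ha, rfl⟩
    · rintro ⟨a, ha, rfl⟩
      exact ⟨a, rfl, ha⟩
  have hb : Function.Bijective (S.endMap L) :=
    Finite.injective_iff_bijective.1 (S.endMap_injective L)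
  have h2 : Set.image (S.endMap L) {a : Fin k → X | Function.Injective (S.endMap L a)} =
      {f : Fin k → X | Function.Injective f} := by
    ext f
    constructor
    · rintro ⟨a, ha, rfl⟩
      exact ha
    · intro hf
      obtain ⟨a, rfl⟩ := hb.2 f
      exact ⟨a, hf, rfl⟩
  rw [h1, Set.ncard_image_of_injective _ (S.word_injective L hpos),
    ← Set.ncard_image_of_injective _ (S.endMap_injective L), h2,
    ← Nat.descFactorial_eq_div hk, ← Nat.card_coe_set_eq,
    show Nat.card {f : Fin k → X | Function.Injective f} = Nat.card (Fin k ↪ X) from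
      Nat.card_congr (Equiv.subtypeInjectiveEquivEmbedding (Fin k) X),
    Nat.card_eq_fintype_card, Fintype.card_embedding_eq, Fintype.card_fin]
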